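/- Let N ≥ 1 be a natural number and ε a real with 1/(N+1) < ε < 1. Define a : Fin (2N) → ℝ by a_v = 1−ε for v < N and a_v = ε for v ≥ N. Then: (a) there exists an assignment σ : Fin (2N) → Fin N with maximum bin load max_n Σ_{v : σ(v) = n} a_v = 1 (pairing each item of cost 1−ε with one item of cost ε); but (b) every nondecreasing map τ : Fin (2N) → Fin N has maximum bin load max_n Σ_{v : τ(v) = n} a_v ≥ 2(1−ε). This shows the approximation ratio 2 of cycle-free (order-preserving) placement is tight. -/

import Mathlib

open scoped BigOperators

theorem sum_two_mul_split (N : ℕ) (f : Fin (2 * N) → ℝ) :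
    ∑ v, f v = ∑ i : Fin N, f ⟨i, by omega⟩ + ∑ i : Fin N, f ⟨N + i, by omega⟩ := by
  have h : N + N = 2 * N := by omega
  rw [← (finCongr h).sum_comp, Fin.sum_univ_add]
  rfl

/-- tightness of the approximation ratio 2 of ordered placement: let
`N ≥ 1` and `1/(N+1) < ε < 1`, and consider `2N` items where the first `N` items have
cost `1−ε` and the last `N` items have cost `ε`.  Then (a) some assignment
`σ : Fin (2N) → Fin N` has maximum bin load exactly `1`, but (b) every nondecreasing map
`τ : Fin (2N) → Fin N` has maximum bin load at least `2(1−ε)`. -/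
theorem ordered_placement_ratio_two_tight (N : ℕ) (hN : 1 ≤ N)
    (ε : ℝ) (hε1 : 1 / ((N : ℝ) + 1) < ε) (hε2 : ε < 1)
    (a : Fin (2 * N) → ℝ)
    (ha : ∀ v : Fin (2 * N), a v = if (v : ℕ) < N then 1 - ε else ε) :
    (∃ σ : Fin (2 * N) → Fin N,
        (⨆ n : Fin N, ∑ v ∈ Finset.univ.filter (fun v => σ v = n), a v) = 1) ∧
    (∀ τ : Fin (2 * N) → Fin N, Monotone τ →
        2 * (1 - ε) ≤ ⨆ n : Fin N, ∑ v ∈ Finset.univ.filter (fun v => τ v = n), a v) := by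
  have hN0 : (0 : ℝ) < (N : ℝ) + 1 := by positivity
  have hε0 : 0 < ε := lt_trans (by positivity) hε1
  have hε3 : 1 < ε * ((N : ℝ) + 1) := by rwa [div_lt_iff₀ hN0] at hε1
  have ha0 : ∀ v, 0 ≤ a v := by
    intro v; rw [ha]; split_ifs <;> linarith
  have : Nonempty (Fin N) := ⟨⟨0, hN⟩⟩
  constructor
  · refine ⟨fun v => ⟨(v : ℕ) % N, Nat.mod_lt _ hN⟩, ?_⟩
    have key : ∀ n : Fin N, ∑ v ∈ Finset.univ.filter
        (fun v : Fin (2 * N) => (⟨(v : ℕ) % N, Nat.mod_lt _ hN⟩ : Fin N) = n), a v = 1 := by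
      intro n
      rw [Finset.sum_filter, sum_two_mul_split]
      have e1 : ∀ i : Fin N, (i : ℕ) % N = i := fun i => Nat.mod_eq_of_lt i.2
      simp [ha, e1]
    simp only [key, ciSup_const]
  · intro τ hτ
    have hb : ∀ n : Fin N, ∑ v ∈ Finset.univ.filter (fun v => τ v = n), a v ≤
        ⨆ n : Fin N, ∑ v ∈ Finset.univ.filter (fun v => τ v = n), a v :=
      fun n => le_ciSup (f := fun n : Fin N =>
        ∑ v ∈ Finset.univ.filter (fun v => τ v = n), a v) (Set.finite_range _).bddAbove n
    by_cases hinj : Function.Injective (fun i : Fin N => τ ⟨i, by omega⟩)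
    · obtain ⟨i, hi⟩ := (Finite.injective_iff_surjective.mp hinj) ⟨N - 1, by omega⟩
      refine le_trans ?_ (hb ⟨N - 1, by omega⟩)
      rw [Finset.sum_filter, sum_two_mul_split]
      have h2 : ∀ j : Fin N, τ ⟨N + j, by omega⟩ = ⟨N - 1, by omega⟩ := by
        intro j
        have h := hτ (show (⟨i, by omega⟩ : Fin (2 * N)) ≤ ⟨N + j, by omega⟩ from by
          rw [Fin.mk_le_mk]; omega)
        simp only at hi
        rw [hi, Fin.le_def] at h
        apply Fin.ext
        have := (τ ⟨N + j, by omega⟩).2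
        simp only at h ⊢
        omega
      have h1 : 1 - ε ≤ ∑ j : Fin N, if τ ⟨j, by omega⟩ = ⟨N - 1, by omega⟩
          then a ⟨j, by omega⟩ else 0 := by
        have := Finset.single_le_sum (f := fun j : Fin N =>
          if τ ⟨j, by omega⟩ = ⟨N - 1, by omega⟩ then a ⟨j, by omega⟩ else 0)
          (fun j _ => by split_ifs; exacts [ha0 _, le_rfl]) (Finset.mem_univ i)
        simp only at hi
        simpa only [hi, if_true, ha, i.2] using this
      have h3 : ∑ j : Fin N, (if τ ⟨N + j, by omega⟩ = ⟨N - 1, by omega⟩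
          then a ⟨N + j, by omega⟩ else 0) = N * ε := by
        simp [h2, ha]
      rw [h3]
      linarith
    · simp only [Function.Injective, not_forall] at hinj
      obtain ⟨i, j, hij, hne⟩ := hinj
      refine le_trans ?_ (hb (τ ⟨i, by omega⟩))
      have hne' : (⟨i, by omega⟩ : Fin (2 * N)) ≠ ⟨j, by omega⟩ := by
        intro h; exact hne (Fin.ext (by simpa using h))
      calc 2 * (1 - ε) = ∑ v ∈ {(⟨i, by omega⟩ : Fin (2 * N)), ⟨j, by omega⟩}, a v := by
            rw [Finset.sum_pair hne', ha, ha]; simp; ring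
        _ ≤ _ := by
            apply Finset.sum_le_sum_of_subset_of_nonneg
            · intro v hv
              simp only [Finset.mem_insert, Finset.mem_singleton] at hv
              rcases hv with rfl | rfl
              · simp
              · simp [hij]
            · intro v _ _; exact ha0 v
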